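/- Let L be an N×N Hermitian positive definite complex matrix and set L' = L + L Δ(L) L. If L' ≠ L (equivalently, Δ(L) ≠ 0), then φ(L') > φ(L); i.e. the ascent of the Picard step is strict unless L is a fixed point of the iteration. -/

import Mathlib

open Matrix
open scoped ComplexOrder

/-- Δ(L) = (1/n)∑ᵢ Uᵢ(Uᵢ*LUᵢ)⁻¹Uᵢ* − (I+L)⁻¹. -/
noncomputable def Delta {N n : ℕ} {k : Fin n → ℕ}
    (U : (i : Fin n) → Matrix (Fin N) (Fin (k i)) ℂ)
    (L : Matrix (Fin N) (Fin N) ℂ) : Matrix (Fin N) (Fin N) ℂ :=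
  (n : ℂ)⁻¹ • (∑ i, U i * ((U i)ᴴ * L * U i)⁻¹ * (U i)ᴴ) - (1 + L)⁻¹

/-- The DPP log-likelihood φ(L) = ∑ᵢ log det(Uᵢ*LUᵢ) − n·log det(I+L). -/
noncomputable def phi {N n : ℕ} {k : Fin n → ℕ}
    (U : (i : Fin n) → Matrix (Fin N) (Fin (k i)) ℂ)
    (L : Matrix (Fin N) (Fin N) ℂ) : ℝ :=
  (∑ i, Real.log (((U i)ᴴ * L * U i).det.re)) - n * Real.log ((1 + L).det.re)

lemma exists_factor {m : ℕ} {B : Matrix (Fin m) (Fin m) ℂ} (hB : B.PosDef) :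
    ∃ R : Matrix (Fin m) (Fin m) ℂ, IsUnit R ∧ Rᴴ * R = B := by
  open scoped MatrixOrder in
  have h0 : 0 ≤ B := hB.posSemidef.nonneg
  have h1 : CFC.sqrt B * CFC.sqrt B = B := CFC.sqrt_mul_sqrt_self B h0
  have h2 : (CFC.sqrt B)ᴴ = CFC.sqrt B := (CFC.sqrt_nonneg B).posSemidef.isHermitian
  refine ⟨CFC.sqrt B, ?_, by rw [h2, h1]⟩
  have := hB.isUnit
  rw [← h1] at this
  exact isUnit_of_mul_isUnit_left this

lemma log_det_aux {m : ℕ} {X : Matrix (Fin m) (Fin m) ℂ} (hX : X.PosDef) :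
    Real.log X.det.re ≤ X.trace.re - m ∧ (X ≠ 1 → Real.log X.det.re < X.trace.re - m) := by
  have hpos := hX.eigenvalues_pos
  have e1 : Real.log X.det.re = ∑ i, Real.log (hX.1.eigenvalues i) := by
    rw [hX.1.det_eq_prod_eigenvalues]
    have : (∏ i, ((hX.1.eigenvalues i : ℝ) : ℂ)) = ((∏ i, hX.1.eigenvalues i : ℝ) : ℂ) := by
      push_cast; rfl
    erw [this]
    rw [Complex.ofReal_re, Real.log_prod (fun i _ => (hpos i).ne')]
  have e2 : X.trace.re - m = ∑ i, (hX.1.eigenvalues i - 1) := by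
    rw [hX.1.trace_eq_sum_eigenvalues]
    simp
  rw [e1, e2]
  refine ⟨Finset.sum_le_sum fun i _ => Real.log_le_sub_one_of_pos (hpos i), fun hne => ?_⟩
  refine Finset.sum_lt_sum (fun i _ => Real.log_le_sub_one_of_pos (hpos i)) ?_
  by_contra! hcon
  apply hne
  have hall : ∀ i, hX.1.eigenvalues i = 1 := by
    intro i
    by_contra h
    exact absurd (hcon i (Finset.mem_univ i)) (not_le.mpr (Real.log_lt_sub_one_of_pos (hpos i) h))
  rw [hX.1.spectral_theorem]
  have : (RCLike.ofReal ∘ hX.1.eigenvalues : Fin m → ℂ) = 1 := by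
    funext i; simp [hall i]
  rw [this]
  have : (diagonal (1 : Fin m → ℂ)) = 1 := diagonal_one
  rw [this, map_one]

lemma log_det_le {m : ℕ} {A B : Matrix (Fin m) (Fin m) ℂ} (hA : A.PosDef) (hB : B.PosDef) :
    Real.log A.det.re - Real.log B.det.re ≤ (B⁻¹ * A).trace.re - m ∧
    (A ≠ B → Real.log A.det.re - Real.log B.det.re < (B⁻¹ * A).trace.re - m) := by
  obtain ⟨R, hR, hRB⟩ := exists_factor hB.inv
  have hX : (R * A * Rᴴ).PosDef :=
    hA.mul_mul_conjTranspose_same (Matrix.vecMul_injective_of_isUnit hR)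
  have ht : (R * A * Rᴴ).trace = (B⁻¹ * A).trace := by
    rw [← hRB, Matrix.trace_mul_comm, Matrix.mul_assoc]
  have hBu := (Matrix.isUnit_iff_isUnit_det _).mp hB.isUnit
  have hd : (R * A * Rᴴ).det * B.det = A.det := by
    have h : (Rᴴ * R).det * B.det = 1 := by
      rw [hRB, ← det_mul, nonsing_inv_mul _ hBu, det_one]
    rw [det_mul] at h
    rw [det_mul, det_mul]
    linear_combination A.det * h
  have hp1 := hX.det_pos
  have hp2 := hB.det_pos
  rw [Complex.pos_iff] at hp1 hp2
  have hl : Real.log A.det.re - Real.log B.det.re = Real.log (R * A * Rᴴ).det.re := by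
    rw [← hd, Complex.mul_re, ← hp1.2, ← hp2.2, zero_mul, sub_zero,
      Real.log_mul hp1.1.ne' hp2.1.ne']
    ring
  rw [hl, ← ht]
  refine ⟨(log_det_aux hX).1, fun hne => (log_det_aux hX).2 fun h => hne ?_⟩
  have hRd := (Matrix.isUnit_iff_isUnit_det _).mp hR
  have h1 : (B⁻¹ * A) * Rᴴ = Rᴴ := by
    rw [← hRB, Matrix.mul_assoc, Matrix.mul_assoc, ← Matrix.mul_assoc R, h, Matrix.mul_one]
  have hRs : IsUnit (Rᴴ).det := by
    rw [det_conjTranspose]; exact hRd.star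
  have h2 : B⁻¹ * A = 1 := by
    have := congrArg (· * (Rᴴ)⁻¹) h1
    simpa [Matrix.mul_assoc, mul_nonsing_inv _ hRs] using this
  have := congrArg (B * ·) h2
  simpa [← Matrix.mul_assoc, mul_nonsing_inv _ hBu] using this

lemma sub_ineq {N k : ℕ} {L L' : Matrix (Fin N) (Fin N) ℂ} (U : Matrix (Fin N) (Fin k) ℂ)
    (hL : L.PosDef) (hL' : L'.PosDef) (hU : Uᴴ * U = 1) :
    (k : ℝ) - ((L * U * (Uᴴ * L * U)⁻¹ * Uᴴ * L) * L'⁻¹).trace.re ≤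
      Real.log (Uᴴ * L' * U).det.re - Real.log (Uᴴ * L * U).det.re := by
  have hinj : Function.Injective U.mulVec := by
    intro x y h
    have := congrArg (Uᴴ *ᵥ ·) h
    simpa [hU] using this
  have hA := hL.conjTranspose_mul_mul_same hinj
  have hB := hL'.conjTranspose_mul_mul_same hinj
  have h1 := (log_det_le hA hB).1
  set A := Uᴴ * L * U with hAdef
  set B := Uᴴ * L' * U with hBdef
  have hAu := (Matrix.isUnit_iff_isUnit_det _).mp hA.isUnit
  have hBu := (Matrix.isUnit_iff_isUnit_det _).mp hB.isUnit
  have hLu := (Matrix.isUnit_iff_isUnit_det _).mp hL'.isUnit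
  have hAh : Aᴴ = A := hA.1
  have hBh : (B⁻¹)ᴴ = B⁻¹ := hB.inv.1
  have hLh : Lᴴ = L := hL.1
  have hSh : (L'⁻¹)ᴴ = L'⁻¹ := hL'.inv.1
  have hY := hL'.posSemidef.conjTranspose_mul_mul_same (L'⁻¹ * L * U - U * B⁻¹ * A)
  have hYe : (L'⁻¹ * L * U - U * B⁻¹ * A)ᴴ * L' * (L'⁻¹ * L * U - U * B⁻¹ * A)
      = Uᴴ * L * L'⁻¹ * L * U - A * B⁻¹ * A := by
    simp only [conjTranspose_sub, conjTranspose_mul, hAh, hBh, hLh, hSh]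
    have e1 : (Uᴴ * (L * L'⁻¹)) * L' = Uᴴ * L := by
      rw [Matrix.mul_assoc, Matrix.mul_assoc, nonsing_inv_mul _ hLu, Matrix.mul_one]
    have e2 : L' * (L'⁻¹ * L * U) = L * U := by
      rw [Matrix.mul_assoc, ← Matrix.mul_assoc L', mul_nonsing_inv _ hLu, Matrix.one_mul]
    have e3 : Uᴴ * L * (U * B⁻¹ * A) = A * B⁻¹ * A := by
      simp only [hAdef, Matrix.mul_assoc]
    have e4 : A * (B⁻¹ * Uᴴ) * (L * U) = A * B⁻¹ * A := by
      rw [hAdef]; simp only [Matrix.mul_assoc]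
    have e5 : A * (B⁻¹ * Uᴴ) * L' * (U * B⁻¹ * A) = A * B⁻¹ * A := by
      have : A * (B⁻¹ * Uᴴ) * L' * (U * B⁻¹ * A) = A * (B⁻¹ * B) * B⁻¹ * A := by
        rw [hBdef]; simp only [Matrix.mul_assoc]
      rw [this, nonsing_inv_mul _ hBu, Matrix.mul_one]
    rw [Matrix.sub_mul, e1, Matrix.sub_mul, Matrix.mul_sub, Matrix.mul_sub, e3, e5,
      Matrix.mul_assoc (A * (B⁻¹ * Uᴴ)), e2, e4]
    simp only [Matrix.mul_assoc, sub_self, sub_zero]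
  rw [hYe] at hY
  obtain ⟨R, hR, hRA⟩ := exists_factor hA.inv
  have h2 := (hY.mul_mul_conjTranspose_same R).trace_nonneg
  rw [Matrix.trace_mul_comm, ← Matrix.mul_assoc, hRA, Matrix.mul_sub, Matrix.trace_sub] at h2
  have e6 : (A⁻¹ * (A * B⁻¹ * A)).trace = (B⁻¹ * A).trace := by
    rw [Matrix.mul_assoc, ← Matrix.mul_assoc, nonsing_inv_mul _ hAu, Matrix.one_mul]
  have e7 : (A⁻¹ * (Uᴴ * L * L'⁻¹ * L * U)).trace
      = ((L * U * A⁻¹ * Uᴴ * L) * L'⁻¹).trace := by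
    have : L * U * A⁻¹ * Uᴴ * L * L'⁻¹ = (L * U) * (A⁻¹ * Uᴴ * L * L'⁻¹) := by
      simp only [Matrix.mul_assoc]
    rw [this, Matrix.trace_mul_comm (L * U)]
    simp only [Matrix.mul_assoc]
  rw [e6, e7, Complex.nonneg_iff, Complex.sub_re] at h2
  linarith [h2.1]

/-- Strict single-step ascent: if L is Hermitian positive definite,
L' = L + L Δ(L) L, and L' ≠ L, then φ(L') > φ(L). -/
theorem picard_step_strict_ascent {N n : ℕ} (hN : 0 < N) (hn : 0 < n)
    {k : Fin n → ℕ} (hk1 : ∀ i, 1 ≤ k i) (hkN : ∀ i, k i ≤ N)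
    (U : (i : Fin n) → Matrix (Fin N) (Fin (k i)) ℂ)
    (hU : ∀ i, (U i)ᴴ * U i = 1)
    (L : Matrix (Fin N) (Fin N) ℂ) (hL : L.PosDef)
    (hne : L + L * Delta U L * L ≠ L) :
    phi U L < phi U (L + L * Delta U L * L) := by
  have hLu := (Matrix.isUnit_iff_isUnit_det _).mp hL.isUnit
  have hS := hL.inv
  have h1L : (1 + L).PosDef := Matrix.PosDef.one.add hL
  have h1S : (1 + L⁻¹).PosDef := Matrix.PosDef.one.add hS
  have h1Lu := (Matrix.isUnit_iff_isUnit_det _).mp h1L.isUnit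
  have h1Su := (Matrix.isUnit_iff_isUnit_det _).mp h1S.isUnit
  have hn0 : (n : ℂ) ≠ 0 := by exact_mod_cast hn.ne'
  have hM : (1 + L⁻¹)⁻¹ = L - L * (1 + L)⁻¹ * L := by
    apply Matrix.inv_eq_left_inv
    have e : L * (1 + L⁻¹) = 1 + L := by
      rw [Matrix.mul_add, mul_nonsing_inv _ hLu, Matrix.mul_one, add_comm]
    rw [Matrix.sub_mul, Matrix.mul_assoc (L * (1 + L)⁻¹), e, Matrix.mul_assoc L,
      nonsing_inv_mul _ h1Lu, Matrix.mul_one]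
    abel
  have hL'e : L + L * Delta U L * L =
      (n : ℂ)⁻¹ • (∑ i, L * U i * ((U i)ᴴ * L * U i)⁻¹ * (U i)ᴴ * L) + (1 + L⁻¹)⁻¹ := by
    rw [hM, Delta, Matrix.mul_sub, Matrix.sub_mul, Matrix.mul_smul, Matrix.smul_mul,
      Matrix.mul_sum, Matrix.sum_mul]
    simp only [Matrix.mul_assoc]
    abel
  have hP : ∀ i, (L * U i * ((U i)ᴴ * L * U i)⁻¹ * (U i)ᴴ * L).PosSemidef := by
    intro i
    have h := ((hL.posSemidef.conjTranspose_mul_mul_same (U i)).inv).mul_mul_conjTranspose_same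
      (L * U i)
    rw [conjTranspose_mul, hL.1.eq] at h
    simpa only [Matrix.mul_assoc] using h
  have hL' : (L + L * Delta U L * L).PosDef := by
    rw [hL'e]
    refine Matrix.PosDef.posSemidef_add ?_ h1S.inv
    refine (Matrix.posSemidef_sum _ fun i _ => hP i).smul ?_
    rw [← Complex.ofReal_natCast, ← Complex.ofReal_inv]
    exact Complex.zero_le_real.mpr (by positivity)
  set L' := L + L * Delta U L * L with hL'def
  have hL'u := (Matrix.isUnit_iff_isUnit_det _).mp hL'.isUnit
  have h1S' : (1 + L'⁻¹).PosDef := Matrix.PosDef.one.add hL'.inv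
  have hdet : ∀ X : Matrix (Fin N) (Fin N) ℂ, X.PosDef →
      Real.log (1 + X).det.re = Real.log X.det.re + Real.log (1 + X⁻¹).det.re := by
    intro X hX
    have hXu := (Matrix.isUnit_iff_isUnit_det _).mp hX.isUnit
    have h1X : (1 + X⁻¹).PosDef := Matrix.PosDef.one.add hX.inv
    have e : 1 + X = X * (1 + X⁻¹) := by
      rw [Matrix.mul_add, mul_nonsing_inv _ hXu, Matrix.mul_one, add_comm]
    have p1 := Complex.pos_iff.mp hX.det_pos
    have p2 := Complex.pos_iff.mp h1X.det_pos
    rw [e, det_mul, Complex.mul_re, ← p1.2, ← p2.2, zero_mul, sub_zero,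
      Real.log_mul p1.1.ne' p2.1.ne']
  have i1 := (log_det_le hL' hL).2 hne
  have i2 := (log_det_le h1S' h1S).1
  have i3 : ∀ i, _ := fun i => sub_ineq (U i) hL hL' (hU i)
  have i4 := Finset.sum_le_sum (s := Finset.univ) fun i _ => i3 i
  rw [Finset.sum_sub_distrib, Finset.sum_sub_distrib] at i4
  set P : Fin n → Matrix (Fin N) (Fin N) ℂ :=
    fun i => L * U i * ((U i)ᴴ * L * U i)⁻¹ * (U i)ᴴ * L with hPdef
  set M := (1 + L⁻¹)⁻¹ with hMdef
  have hsum : ∑ i, P i = (n : ℂ) • (L' - M) := by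
    rw [hL'e, add_sub_cancel_right, smul_smul, mul_inv_cancel₀ hn0, one_smul]
  have t1 : ∑ i, ((P i) * L'⁻¹).trace.re = n * (N - (M * L'⁻¹).trace.re) := by
    rw [← Complex.re_sum, ← Matrix.trace_sum, ← Matrix.sum_mul, hsum, Matrix.smul_mul,
      Matrix.sub_mul, mul_nonsing_inv _ hL'u, Matrix.trace_smul, Matrix.trace_sub,
      Matrix.trace_one]
    simp
  have t2 : ∑ i, (k i : ℝ) = n * ((L⁻¹ * L').trace.re - (M * L⁻¹).trace.re) := by
    have hk : ∀ i, (k i : ℝ) = ((P i) * L⁻¹).trace.re := by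
      intro i
      have hinj : Function.Injective (U i).mulVec := by
        intro x y h
        have := congrArg ((U i)ᴴ *ᵥ ·) h
        simpa [hU i] using this
      have hA := hL.conjTranspose_mul_mul_same hinj
      have hAu := (Matrix.isUnit_iff_isUnit_det _).mp hA.isUnit
      have e : P i * L⁻¹ = (L * U i) * (((U i)ᴴ * L * U i)⁻¹ * (U i)ᴴ) := by
        rw [hPdef]
        simp only [Matrix.mul_assoc, mul_nonsing_inv _ hLu, Matrix.mul_one]
      rw [e, Matrix.trace_mul_comm, Matrix.mul_assoc, ← Matrix.mul_assoc (U i)ᴴ,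
        nonsing_inv_mul _ hAu, Matrix.trace_one]
      simp
    simp_rw [hk]
    rw [← Complex.re_sum, ← Matrix.trace_sum, ← Matrix.sum_mul, hsum, Matrix.smul_mul,
      Matrix.sub_mul, Matrix.trace_smul, Matrix.trace_sub, Matrix.trace_mul_comm L']
    simp
  have t3 : (M * (1 + L'⁻¹)).trace.re = M.trace.re + (M * L'⁻¹).trace.re := by
    rw [Matrix.mul_add, Matrix.mul_one, Matrix.trace_add, Complex.add_re]
  have t4 : M.trace.re + (M * L⁻¹).trace.re = N := by
    rw [← Complex.add_re, ← Matrix.trace_add]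
    have : M + M * L⁻¹ = 1 := by
      rw [← nonsing_inv_mul _ h1Su, Matrix.mul_add, Matrix.mul_one]
    rw [this, Matrix.trace_one]
    simp
  rw [t1, t2] at i4
  rw [t3] at i2
  have hn' : (0 : ℝ) < n := by exact_mod_cast hn
  simp only [phi]
  rw [hdet L hL, hdet L' hL']
  have i5 : (n : ℝ) * (Real.log L'.det.re + Real.log (1 + L'⁻¹).det.re
      - (Real.log L.det.re + Real.log (1 + L⁻¹).det.re)) <
      n * (((L⁻¹ * L').trace.re - (M * L⁻¹).trace.re) - (N - (M * L'⁻¹).trace.re)) := by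
    apply mul_lt_mul_of_pos_left _ hn'
    linarith
  rw [mul_sub, mul_sub] at i5
  linarith
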